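/- Let A ∈ ℂ^{n×n} be a negative definite Hermitian matrix, p ≤ n, and μ > |λ_min(A)|. If X ∈ OB(n,p) is a local minimizer of g_μ(X) = (1/2) tr(X*AX) + (μ/4) tr((X*X)(X*X)) over OB(n,p), then there exist a matrix Q_p ∈ ℂ^{n×p} whose columns are orthonormal eigenvectors of A corresponding to the p smallest eigenvalues of A counted with multiplicity (so A Q_p = Q_p Λ_p with Λ_p diagonal) and a unitary matrix V ∈ ℂ^{p×p} such that X = Q_p (I − (Λ_p − Λ̄_p)/μ)^{1/2} V^*, where Λ̄_p = (tr(Λ_p)/p) I. -/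

import Mathlib

open Matrix Finset

noncomputable section

/-- The oblique manifold `OB(n,p)`: complex `n × p` matrices all of whose columns have
unit norm, i.e. every diagonal entry of `Xᴴ * X` equals `1`. -/
def OBset (n p : ℕ) : Set (Matrix (Fin n) (Fin p) ℂ) :=
  {X | ∀ j, (Xᴴ * X) j j = 1}

/-- Frobenius norm of a complex matrix. -/
def frobNorm {n p : ℕ} (X : Matrix (Fin n) (Fin p) ℂ) : ℝ :=
  Real.sqrt (∑ i, ∑ j, Complex.normSq (X i j))

/-- The eigenvalues of a Hermitian matrix, listed in nondecreasing order
(counted with multiplicity). -/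
def sortedEig {n : ℕ} {A : Matrix (Fin n) (Fin n) ℂ} (hA : A.IsHermitian) : Fin n → ℝ :=
  fun i => hA.eigenvalues (Tuple.sort hA.eigenvalues i)

/-- The qTPM objective `g_μ(X) = (1/2) tr(X*AX) + (μ/4) tr((X*X)(X*X))`. -/
def gmu {n p : ℕ} (A : Matrix (Fin n) (Fin n) ℂ) (μ : ℝ)
    (X : Matrix (Fin n) (Fin p) ℂ) : ℝ :=
  (1 / 2) * (Xᴴ * A * X).trace.re + (μ / 4) * ((Xᴴ * X) * (Xᴴ * X)).trace.re

open Filter Topology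

lemma star_dotProduct_self {m : ℕ} (x : Fin m → ℂ) :
    star x ⬝ᵥ x = ((∑ i, Complex.normSq (x i) : ℝ) : ℂ) := by
  simp [dotProduct, Complex.normSq_eq_conj_mul_self]

lemma dotProduct_self_nonneg {m : ℕ} (x : Fin m → ℂ) : 0 ≤ (star x ⬝ᵥ x).re := by
  rw [star_dotProduct_self, Complex.ofReal_re]
  exact Finset.sum_nonneg fun i _ => Complex.normSq_nonneg _

lemma dotProduct_self_ofReal {m : ℕ} (x : Fin m → ℂ) :
    (((star x ⬝ᵥ x).re : ℝ) : ℂ) = star x ⬝ᵥ x := by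
  rw [star_dotProduct_self, Complex.ofReal_re]

lemma eq_zero_of_dotProduct_self_re {m : ℕ} {x : Fin m → ℂ} (h : (star x ⬝ᵥ x).re = 0) :
    x = 0 := by
  open scoped ComplexOrder in
  rw [← dotProduct_star_self_eq_zero, ← dotProduct_self_ofReal, h, Complex.ofReal_zero]

lemma Matrix.IsHermitian.star_dotProduct_mulVec {m : ℕ} {B : Matrix (Fin m) (Fin m) ℂ}
    (hB : B.IsHermitian) (x y : Fin m → ℂ) :
    star x ⬝ᵥ B *ᵥ y = star (B *ᵥ x) ⬝ᵥ y := by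
  rw [star_mulVec, hB.eq, dotProduct_mulVec]

lemma Matrix.IsHermitian.star_dotProduct_mulVec_comm {m : ℕ} {B : Matrix (Fin m) (Fin m) ℂ}
    (hB : B.IsHermitian) (x y : Fin m → ℂ) :
    star (star x ⬝ᵥ B *ᵥ y) = star y ⬝ᵥ B *ᵥ x := by
  rw [hB.star_dotProduct_mulVec y x, star_dotProduct (B *ᵥ y)]

lemma Matrix.IsHermitian.dotProduct_ofReal {m : ℕ} {B : Matrix (Fin m) (Fin m) ℂ}
    (hB : B.IsHermitian) (x : Fin m → ℂ) :
    (((star x ⬝ᵥ B *ᵥ x).re : ℝ) : ℂ) = star x ⬝ᵥ B *ᵥ x :=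
  Complex.conj_eq_iff_re.mp (hB.star_dotProduct_mulVec_comm x x)

lemma gmu_eq {n p : ℕ} (A : Matrix (Fin n) (Fin n) ℂ) (μ : ℝ) (X : Matrix (Fin n) (Fin p) ℂ) :
    gmu A μ X = (1 / 2) * (A * (X * Xᴴ)).trace.re + (μ / 4) * ((X * Xᴴ) * (X * Xᴴ)).trace.re := by
  rw [gmu, Matrix.trace_mul_comm (Xᴴ * A), Matrix.trace_mul_comm A, Matrix.mul_assoc Xᴴ X,
    Matrix.trace_mul_comm Xᴴ]
  simp only [Matrix.mul_assoc]

lemma mem_OBset_iff {n p : ℕ} {X : Matrix (Fin n) (Fin p) ℂ} :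
    X ∈ OBset n p ↔ ∀ j, star (X.col j) ⬝ᵥ X.col j = 1 := Iff.rfl

lemma updateCol_mul_conjTranspose {n p : ℕ} (X : Matrix (Fin n) (Fin p) ℂ) (j : Fin p)
    (y : Fin n → ℂ) :
    X.updateCol j y * (X.updateCol j y)ᴴ =
      X * Xᴴ + (vecMulVec y (star y) - vecMulVec (X.col j) (star (X.col j))) := by
  ext i k
  simp only [Matrix.mul_apply, Matrix.add_apply, Matrix.sub_apply, conjTranspose_apply,
    vecMulVec_apply]
  rw [Fintype.sum_eq_add_sum_compl j, Fintype.sum_eq_add_sum_compl j]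
  have : ∑ l ∈ {j}ᶜ, X.updateCol j y i l * star (X.updateCol j y k l) =
      ∑ l ∈ {j}ᶜ, X i l * star (X k l) := by
    refine Finset.sum_congr rfl fun l hl => ?_
    have hl : l ≠ j := by simpa using hl
    simp [hl]
  rw [this]
  simp [col_apply]
  ring

lemma updateCol_mem_OBset {n p : ℕ} {X : Matrix (Fin n) (Fin p) ℂ} (hX : X ∈ OBset n p)
    (j : Fin p) {y : Fin n → ℂ} (hy : star y ⬝ᵥ y = 1) : X.updateCol j y ∈ OBset n p := by
  rw [mem_OBset_iff] at hX ⊢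
  intro k
  by_cases hk : k = j
  · subst hk
    have : (X.updateCol k y).col k = y := by ext i; simp
    rw [this, hy]
  · have : (X.updateCol j y).col k = X.col k := by ext i; simp [hk]
    rw [this, hX]

lemma gmu_updateCol {n p : ℕ} (A : Matrix (Fin n) (Fin n) ℂ) (μ : ℝ)
    {X : Matrix (Fin n) (Fin p) ℂ} (hX : X ∈ OBset n p) (j : Fin p) {y : Fin n → ℂ}
    (hy : star y ⬝ᵥ y = 1) :
    gmu A μ (X.updateCol j y) - gmu A μ X =
      (1 / 2) * ((star y ⬝ᵥ (A + (μ : ℂ) • (X * Xᴴ)) *ᵥ y).re -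
        (star (X.col j) ⬝ᵥ (A + (μ : ℂ) • (X * Xᴴ)) *ᵥ X.col j).re) +
      (μ / 2) * (1 - Complex.normSq (star (X.col j) ⬝ᵥ y)) := by
  have hx : star (X.col j) ⬝ᵥ X.col j = 1 := hX j
  rw [gmu_eq, gmu_eq, updateCol_mul_conjTranspose]
  generalize X.col j = x at *
  generalize X * Xᴴ = Z
  have key : ∀ (M : Matrix (Fin n) (Fin n) ℂ) (z : Fin n → ℂ),
      (M * vecMulVec z (star z)).trace = star z ⬝ᵥ M *ᵥ z := by
    intro M z
    rw [mul_vecMulVec, trace_vecMulVec, dotProduct_comm]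
  have h1 : (star x ⬝ᵥ y) * (star y ⬝ᵥ x) = (Complex.normSq (star x ⬝ᵥ y) : ℂ) := by
    rw [star_dotProduct y x, Complex.normSq_eq_conj_mul_self, mul_comm]; rfl
  have h2 : ((vecMulVec y (star y) - vecMulVec x (star x)) *
      (vecMulVec y (star y) - vecMulVec x (star x))).trace =
      ((2 - 2 * Complex.normSq (star x ⬝ᵥ y) : ℝ) : ℂ) := by
    simp only [mul_sub, Matrix.trace_sub, key, Matrix.sub_mulVec, vecMulVec_mulVec, dotProduct_sub,
      hx, hy, dotProduct_smul, op_smul_eq_smul, smul_eq_mul]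
    push_cast
    rw [← h1]
    ring
  simp only [mul_add, add_mul, Matrix.trace_add, h2, Matrix.trace_mul_comm _ Z]
  simp only [mul_sub, Matrix.trace_sub, key, Matrix.add_mulVec, Matrix.smul_mulVec, dotProduct_add,
    dotProduct_smul, smul_eq_mul, Complex.add_re, Complex.sub_re, Complex.re_ofReal_mul,
    Complex.ofReal_re]
  ring

lemma continuous_frobNorm_sub {n p : ℕ} (X : Matrix (Fin n) (Fin p) ℂ) :
    Continuous fun Y : Matrix (Fin n) (Fin p) ℂ => frobNorm (Y - X) := by
  unfold frobNorm
  refine Real.continuous_sqrt.comp ?_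
  refine continuous_finsetSum _ fun i _ => continuous_finsetSum _ fun j _ => ?_
  exact Complex.continuous_normSq.comp ((continuous_id.sub continuous_const).matrix_elem i j)

lemma isLocalMinOn_of_frobNorm {n p : ℕ} {g : Matrix (Fin n) (Fin p) ℂ → ℝ}
    {S : Set (Matrix (Fin n) (Fin p) ℂ)} {X : Matrix (Fin n) (Fin p) ℂ}
    (hmin : ∃ δ > (0 : ℝ), ∀ Y ∈ S, frobNorm (Y - X) < δ → g X ≤ g Y) :
    ∀ᶠ Y in 𝓝 X, Y ∈ S → g X ≤ g Y := by
  obtain ⟨δ, hδ, h⟩ := hmin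
  have h0 : frobNorm (X - X) < δ := by simpa [frobNorm] using hδ
  filter_upwards [(continuous_frobNorm_sub X).continuousAt.eventually_lt
    continuousAt_const h0] with Y hY hS
  exact h Y hS hY

lemma continuous_updateCol {n p : ℕ} (X : Matrix (Fin n) (Fin p) ℂ) (j : Fin p) {y : ℝ → Fin n → ℂ}
    (hy : Continuous y) : Continuous fun t => X.updateCol j (y t) :=
  continuous_const.matrix_updateCol j hy

lemma nonneg_of_eventually_mul_nonneg {f : ℝ → ℝ} (hf : ContinuousAt f 0) {k : ℕ}
    (h : ∀ᶠ t in 𝓝 (0 : ℝ), 0 ≤ t ^ k * f t) : 0 ≤ f 0 := by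
  have h2 : ∀ᶠ t in 𝓝[>] (0 : ℝ), 0 ≤ f t := by
    filter_upwards [nhdsWithin_le_nhds h, self_mem_nhdsWithin] with t ht ht0
    exact nonneg_of_mul_nonneg_right ht (pow_pos ht0 k)
  exact ge_of_tendsto (hf.tendsto.mono_left nhdsWithin_le_nhds) h2

lemma isHermitian_add_smul {n p : ℕ} {A : Matrix (Fin n) (Fin n) ℂ} (hA : A.IsHermitian) (μ : ℝ)
    (X : Matrix (Fin n) (Fin p) ℂ) : (A + (μ : ℂ) • (X * Xᴴ)).IsHermitian := by
  refine hA.add ?_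
  simp [Matrix.IsHermitian, conjTranspose_smul]

/-- First-order stationarity: every column of a local minimizer is an eigenvector of
`A + μ X Xᴴ`. -/
lemma col_eigenvector_of_isLocalMin {n p : ℕ} {A : Matrix (Fin n) (Fin n) ℂ} (hA : A.IsHermitian)
    (μ : ℝ) {X : Matrix (Fin n) (Fin p) ℂ} (hX : X ∈ OBset n p)
    (hmin : ∀ᶠ Y in 𝓝 X, Y ∈ OBset n p → gmu A μ X ≤ gmu A μ Y) (j : Fin p) :
    ∃ d : ℝ, (A + (μ : ℂ) • (X * Xᴴ)) *ᵥ X.col j = (d : ℂ) • X.col j := by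
  have hB := isHermitian_add_smul hA μ X
  have hgmu := fun y => gmu_updateCol A μ hX j (y := y)
  have hx : star (X.col j) ⬝ᵥ X.col j = 1 := hX j
  set B := A + (μ : ℂ) • (X * Xᴴ)
  set x := X.col j with hxdef
  set d : ℝ := (star x ⬝ᵥ B *ᵥ x).re with hd
  have hdc : (d : ℂ) = star x ⬝ᵥ B *ᵥ x := hB.dotProduct_ofReal x
  refine ⟨d, ?_⟩
  set w := B *ᵥ x - (d : ℂ) • x with hw
  have hBx : B *ᵥ x = w + (d : ℂ) • x := by rw [hw]; abel
  have hxw : star x ⬝ᵥ w = 0 := by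
    rw [hw, dotProduct_sub, ← hdc, dotProduct_smul, hx]; simp
  have hwx : star w ⬝ᵥ x = 0 := by rw [star_dotProduct, hxw, star_zero]
  set N : ℝ := (star w ⬝ᵥ w).re with hN
  have hNc : (N : ℂ) = star w ⬝ᵥ w := dotProduct_self_ofReal w
  have hN0 : 0 ≤ N := dotProduct_self_nonneg w
  have hwBx : star w ⬝ᵥ B *ᵥ x = N := by
    rw [hBx, dotProduct_add, dotProduct_smul, hwx, hNc]; simp
  have hxBw : star x ⬝ᵥ B *ᵥ w = N := by
    rw [← hB.star_dotProduct_mulVec_comm, hwBx]; exact Complex.conj_ofReal N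
  set q : ℝ := (star w ⬝ᵥ B *ᵥ w).re with hq
  have hqc : (q : ℂ) = star w ⬝ᵥ B *ᵥ w := hB.dotProduct_ofReal w
  let c : ℝ → ℝ := fun t => Real.sqrt (1 - t ^ 2 * N)
  have hc : Continuous c := by fun_prop
  let y : ℝ → Fin n → ℂ := fun t => (c t : ℂ) • x - (t : ℂ) • w
  have hy : Continuous y := by fun_prop
  have hc0 : c 0 = 1 := by simp [c]
  have hy0 : y 0 = x := by simp [y, hc0]
  have hev : ∀ᶠ t in 𝓝 (0 : ℝ), 0 < 1 - t ^ 2 * N := by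
    refine continuousAt_const.eventually_lt (by fun_prop) ?_
    simp
  have hloc : ∀ᶠ t in 𝓝 (0 : ℝ), X.updateCol j (y t) ∈ OBset n p →
      gmu A μ X ≤ gmu A μ (X.updateCol j (y t)) := by
    have hcont : Tendsto (fun t => X.updateCol j (y t)) (𝓝 0) (𝓝 X) := by
      have := (continuous_updateCol X j hy).tendsto 0
      rwa [hy0, hxdef, show X.updateCol j (X.col j) = X from updateCol_eq_self X j] at this
    exact hcont.eventually hmin
  have hfin : ∀ᶠ t in 𝓝 (0 : ℝ), 0 ≤ t ^ 1 * (t * ((q - N * d) / 2 + μ / 2 * N) - c t * N) := by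
    filter_upwards [hev, hloc] with t ht hl
    have hct : c t ^ 2 = 1 - t ^ 2 * N := Real.sq_sqrt ht.le
    have hctc : (c t : ℂ) ^ 2 = 1 - (t : ℂ) ^ 2 * N := by exact_mod_cast hct
    have hstar : star (y t) = (c t : ℂ) • star x - (t : ℂ) • star w := by
      ext i; simp [y]
    have hyy : star (y t) ⬝ᵥ y t = 1 := by
      rw [hstar]
      simp only [y, sub_dotProduct, dotProduct_sub, smul_dotProduct, dotProduct_smul, hx, hxw, hwx,
        ← hNc, smul_eq_mul]
      linear_combination hctc
    have hxy : star x ⬝ᵥ y t = c t := by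
      simp [y, dotProduct_sub, hx, hxw]
    have hyBy : star (y t) ⬝ᵥ B *ᵥ y t = ((c t ^ 2 * d - 2 * c t * t * N + t ^ 2 * q : ℝ) : ℂ) := by
      rw [hstar]
      simp only [y, mulVec_sub, mulVec_smul, sub_dotProduct, dotProduct_sub, smul_dotProduct,
        dotProduct_smul, hwBx, hxBw, ← hqc, ← hdc, smul_eq_mul]
      push_cast
      ring
    have h1 := hgmu (y t) hyy
    have h2 := hl (updateCol_mem_OBset hX j hyy)
    rw [hxy, hyBy, Complex.ofReal_re, Complex.normSq_ofReal, ← pow_two, hct] at h1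
    calc (0 : ℝ) ≤ gmu A μ (X.updateCol j (y t)) - gmu A μ X := sub_nonneg.mpr h2
      _ = _ := by rw [h1]; ring
  have := nonneg_of_eventually_mul_nonneg (by fun_prop) hfin
  rw [hc0] at this
  have hNz : N = 0 := by linarith
  have hw0 : w = 0 := eq_zero_of_dotProduct_self_re hNz
  rw [hBx, hw0, zero_add]

lemma dotProduct_eq_zero_of_eigenvalue_ne {m : ℕ} {B : Matrix (Fin m) (Fin m) ℂ}
    (hB : B.IsHermitian) {x y : Fin m → ℂ} {a b : ℝ} (hx : B *ᵥ x = (a : ℂ) • x)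
    (hy : B *ᵥ y = (b : ℂ) • y) (hab : a ≠ b) : star x ⬝ᵥ y = 0 := by
  have h := hB.star_dotProduct_mulVec x y
  rw [hx, hy, dotProduct_smul, star_smul, smul_dotProduct] at h
  simp only [RCLike.star_def, Complex.conj_ofReal, smul_eq_mul] at h
  have hne : (b : ℂ) - a ≠ 0 := sub_ne_zero.mpr (by exact_mod_cast hab.symm)
  exact (mul_eq_zero.mp (show ((b : ℂ) - a) * (star x ⬝ᵥ y) = 0 by linear_combination h)).resolve_left
    hne

/-- The multipliers of all columns of a local minimizer coincide: otherwise two columns can be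
rotated into each other without changing the objective, and stationarity fails nearby. -/
lemma multiplier_eq_of_isLocalMin {n p : ℕ} {A : Matrix (Fin n) (Fin n) ℂ} (hA : A.IsHermitian)
    (μ : ℝ) {X : Matrix (Fin n) (Fin p) ℂ} (hX : X ∈ OBset n p)
    (hmin : ∀ᶠ Y in 𝓝 X, Y ∈ OBset n p → gmu A μ X ≤ gmu A μ Y) {i j : Fin p} {a b : ℝ}
    (ha : (A + (μ : ℂ) • (X * Xᴴ)) *ᵥ X.col i = (a : ℂ) • X.col i)
    (hb : (A + (μ : ℂ) • (X * Xᴴ)) *ᵥ X.col j = (b : ℂ) • X.col j) : a = b := by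
  by_contra hab
  have hB := isHermitian_add_smul hA μ X
  have hij : i ≠ j := by
    rintro rfl
    have h := congrArg (star (X.col i) ⬝ᵥ ·) (ha.symm.trans hb)
    simp only [dotProduct_smul, mem_OBset_iff.mp hX i, smul_eq_mul, mul_one] at h
    exact hab (by exact_mod_cast h)
  have hxy := dotProduct_eq_zero_of_eigenvalue_ne hB ha hb hab
  have hyx : star (X.col j) ⬝ᵥ X.col i = 0 := by rw [star_dotProduct, hxy, star_zero]
  have hx : star (X.col i) ⬝ᵥ X.col i = 1 := hX i
  have hy : star (X.col j) ⬝ᵥ X.col j = 1 := hX j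
  let u : ℝ → Fin n → ℂ := fun t => (Real.cos t : ℂ) • X.col i + (Real.sin t : ℂ) • X.col j
  let v : ℝ → Fin n → ℂ := fun t => (Real.cos t : ℂ) • X.col j - (Real.sin t : ℂ) • X.col i
  let Y : ℝ → Matrix (Fin n) (Fin p) ℂ := fun t => (X.updateCol j (v t)).updateCol i (u t)
  have hcs : ∀ t : ℝ, (Real.cos t : ℂ) ^ 2 + (Real.sin t : ℂ) ^ 2 = 1 := fun t => by
    exact_mod_cast Real.cos_sq_add_sin_sq t
  have hsu : ∀ t, star (u t) =
      (Real.cos t : ℂ) • star (X.col i) + (Real.sin t : ℂ) • star (X.col j) := fun t => by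
    ext k; simp [u, -Complex.ofReal_cos, -Complex.ofReal_sin]
  have hsv : ∀ t, star (v t) =
      (Real.cos t : ℂ) • star (X.col j) - (Real.sin t : ℂ) • star (X.col i) := fun t => by
    ext k; simp [v, -Complex.ofReal_cos, -Complex.ofReal_sin]
  have huu : ∀ t, star (u t) ⬝ᵥ u t = 1 := fun t => by
    rw [hsu]
    simp only [u, add_dotProduct, dotProduct_add, smul_dotProduct, dotProduct_smul, hx, hy, hxy, hyx,
      smul_eq_mul]
    linear_combination hcs t
  have hvv : ∀ t, star (v t) ⬝ᵥ v t = 1 := fun t => by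
    rw [hsv]
    simp only [v, sub_dotProduct, dotProduct_sub, smul_dotProduct, dotProduct_smul, hx, hy, hxy, hyx,
      smul_eq_mul]
    linear_combination hcs t
  have hYOB : ∀ t, Y t ∈ OBset n p := fun t =>
    updateCol_mem_OBset (updateCol_mem_OBset hX j (hvv t)) i (huu t)
  have hYcol : ∀ t, (Y t).col i = u t := fun t => by ext k; simp [Y]
  have hYY : ∀ t, Y t * (Y t)ᴴ = X * Xᴴ := fun t => by
    have hcol : (X.updateCol j (v t)).col i = X.col i := by ext k; simp [hij]
    rw [updateCol_mul_conjTranspose, updateCol_mul_conjTranspose, hcol, hsu, hsv]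
    ext k l
    simp only [u, v, Matrix.add_apply, Matrix.sub_apply, vecMulVec_apply, Pi.add_apply,
      Pi.sub_apply, Pi.smul_apply, smul_eq_mul]
    linear_combination (X.col i k * star (X.col i) l + X.col j k * star (X.col j) l) * hcs t
  have hgY : ∀ t, gmu A μ (Y t) = gmu A μ X := fun t => by rw [gmu_eq, gmu_eq, hYY]
  have hYcont : Continuous Y := by
    have hu : Continuous u := by fun_prop
    have hv : Continuous v := by fun_prop
    exact (continuous_updateCol X j hv).matrix_updateCol i hu
  have hY0 : Y 0 = X := by
    simp only [Y, u, v, Real.cos_zero, Real.sin_zero, Complex.ofReal_one, Complex.ofReal_zero,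
      one_smul, zero_smul, add_zero, sub_zero]
    rw [show X.updateCol j (X.col j) = X from updateCol_eq_self X j]
    exact updateCol_eq_self X i
  have hev : ∀ᶠ t in 𝓝 (0 : ℝ), ∀ᶠ Z in 𝓝 (Y t), Z ∈ OBset n p → gmu A μ X ≤ gmu A μ Z := by
    have := hYcont.tendsto 0
    rw [hY0] at this
    exact this.eventually (eventually_eventually_nhds.mpr hmin)
  have hcos : ∀ᶠ t in 𝓝 (0 : ℝ), 0 < Real.cos t :=
    continuousAt_const.eventually_lt Real.continuous_cos.continuousAt (by simp)
  have hsin : ∀ᶠ t in 𝓝[>] (0 : ℝ), 0 < Real.sin t := by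
    filter_upwards [Ioo_mem_nhdsGT Real.pi_pos] with t ht
    exact Real.sin_pos_of_pos_of_lt_pi ht.1 ht.2
  obtain ⟨t, ⟨ht1, ht2⟩, ht3⟩ := (((hev.and hcos).filter_mono nhdsWithin_le_nhds).and hsin).exists
  rw [← hgY t] at ht1
  obtain ⟨d, hd⟩ := col_eigenvector_of_isLocalMin hA μ (hYOB t) ht1 i
  rw [hYY, hYcol] at hd
  simp only [u, mulVec_add, mulVec_smul, ha, hb] at hd
  have e1 := congrArg (star (X.col i) ⬝ᵥ ·) hd
  have e2 := congrArg (star (X.col j) ⬝ᵥ ·) hd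
  simp only [dotProduct_add, dotProduct_smul, hx, hy, hxy, hyx, smul_eq_mul, mul_one, mul_zero,
    add_zero, zero_add] at e1 e2
  norm_cast at e1 e2
  have h1 : a = d := mul_left_cancel₀ ht2.ne' (by linarith)
  have h2 : b = d := mul_left_cancel₀ ht3.ne' (by linarith)
  exact hab (h1.trans h2.symm)

lemma stationary_of_isLocalMin {n p : ℕ} (hp : 0 < p) {A : Matrix (Fin n) (Fin n) ℂ}
    (hA : A.IsHermitian) (μ : ℝ) {X : Matrix (Fin n) (Fin p) ℂ} (hX : X ∈ OBset n p)
    (hmin : ∀ᶠ Y in 𝓝 X, Y ∈ OBset n p → gmu A μ X ≤ gmu A μ Y) :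
    ∃ d : ℝ, A * X = (d : ℂ) • X - (μ : ℂ) • (X * (Xᴴ * X)) := by
  choose d hd using col_eigenvector_of_isLocalMin hA μ hX hmin
  refine ⟨d ⟨0, hp⟩, ?_⟩
  rw [eq_sub_iff_add_eq, ← Matrix.mul_assoc, ← Matrix.smul_mul, ← Matrix.add_mul]
  ext i j
  have h := congrFun (hd j) i
  rw [multiplier_eq_of_isLocalMin hA μ hX hmin (hd j) (hd ⟨0, hp⟩)] at h
  exact h

/-- Second-order condition of a local minimizer along the direction `U Vᴴ`, where `U` is
orthogonal to the range of `X`. -/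
lemma second_order_of_isLocalMin {n p : ℕ} {A : Matrix (Fin n) (Fin n) ℂ}
    (hA : A.IsHermitian) (μ : ℝ) {X : Matrix (Fin n) (Fin p) ℂ} (hX : X ∈ OBset n p)
    (hmin : ∀ᶠ Y in 𝓝 X, Y ∈ OBset n p → gmu A μ X ≤ gmu A μ Y) {d : ℝ}
    (hd : A * X = (d : ℂ) • X - (μ : ℂ) • (X * (Xᴴ * X)))
    {U : Matrix (Fin n) (Fin 1) ℂ} {V : Matrix (Fin p) (Fin 1) ℂ}
    (hU : Uᴴ * U = 1) (hV : Vᴴ * V = 1) (hXU : Xᴴ * U = 0) :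
    d ≤ (Uᴴ * A * U).trace.re + μ * ((Xᴴ * X) * (V * Vᴴ)).trace.re := by
  have hUX : Uᴴ * X = 0 := by
    rw [← conjTranspose_conjTranspose X, ← conjTranspose_mul, hXU, conjTranspose_zero]
  have hUAX : Uᴴ * (A * X) = 0 := by
    rw [hd, Matrix.mul_sub, Matrix.mul_smul, Matrix.mul_smul, ← Matrix.mul_assoc, hUX]
    simp
  have hXAU : Xᴴ * (A * U) = 0 := by
    have := congrArg conjTranspose hUAX
    simpa [conjTranspose_mul, hA.eq, Matrix.mul_assoc] using this
  set G := Xᴴ * X with hG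
  have hXAX : Xᴴ * (A * X) = (d : ℂ) • G - (μ : ℂ) • (G * G) := by
    rw [hd, Matrix.mul_sub, Matrix.mul_smul, Matrix.mul_smul, ← Matrix.mul_assoc]
  let ω : Fin p → ℝ := fun j => Complex.normSq (V j 0)
  let c : Fin p → ℝ → ℝ := fun j t => Real.sqrt (1 - t ^ 2 * ω j)
  let C : ℝ → Matrix (Fin p) (Fin p) ℂ := fun t => diagonal fun j => (c j t : ℂ)
  let W : Matrix (Fin p) (Fin p) ℂ := diagonal fun j => (ω j : ℂ)
  have hω : ∑ j, (ω j : ℂ) = 1 := by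
    have := congrFun (congrFun hV 0) 0
    simpa [Matrix.mul_apply, ω, Complex.normSq_eq_conj_mul_self] using this
  have hCcont : Continuous C := by
    refine Continuous.matrix_diagonal (continuous_pi fun j => ?_)
    fun_prop
  have hC0 : C 0 = 1 := by simp [C, c]
  have hCH : ∀ t, (C t)ᴴ = C t := fun t => by
    simp [C, diagonal_conjTranspose, Pi.star_def]
  have hWG : (W * G).trace = 1 := by
    simp only [W, Matrix.trace, Matrix.diag_apply, diagonal_mul, hG]
    simp only [show ∀ j, (Xᴴ * X) j j = 1 from hX, mul_one, hω]
  let Y : ℝ → Matrix (Fin n) (Fin p) ℂ := fun t => X * C t + (t : ℂ) • (U * Vᴴ)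
  have hYcont : Continuous Y := by fun_prop
  have hY0 : Y 0 = X := by simp [Y, hC0]
  have hYH : ∀ t, (Y t)ᴴ = C t * Xᴴ + (t : ℂ) • (V * Uᴴ) := fun t => by
    simp [Y, hCH, conjTranspose_mul, conjTranspose_smul]
  have hYY : ∀ t, (Y t)ᴴ * Y t = C t * G * C t + ((t : ℂ) ^ 2) • (V * Vᴴ) := fun t => by
    rw [hYH]
    have e1 : C t * Xᴴ * (U * Vᴴ) = 0 := by
      rw [Matrix.mul_assoc, ← Matrix.mul_assoc Xᴴ, hXU]; simp
    have e2 : V * Uᴴ * (X * C t) = 0 := by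
      rw [Matrix.mul_assoc, ← Matrix.mul_assoc Uᴴ, hUX]; simp
    have e3 : V * Uᴴ * (U * Vᴴ) = V * Vᴴ := by
      rw [Matrix.mul_assoc, ← Matrix.mul_assoc Uᴴ, hU, Matrix.one_mul]
    have e4 : C t * Xᴴ * (X * C t) = C t * G * C t := by simp only [hG, Matrix.mul_assoc]
    simp only [Y, Matrix.add_mul, Matrix.mul_add, Matrix.smul_mul, Matrix.mul_smul, e1, e2, e3, e4,
      smul_zero, add_zero, zero_add, smul_smul, pow_two]
  have hYAY : ∀ t, (Y t)ᴴ * A * Y t = C t * ((d : ℂ) • G - (μ : ℂ) • (G * G)) * C t +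
      ((t : ℂ) ^ 2) • (V * (Uᴴ * A * U) * Vᴴ) := fun t => by
    rw [hYH]
    have e1 : C t * (Xᴴ * (A * (U * Vᴴ))) = 0 := by
      rw [← Matrix.mul_assoc A, ← Matrix.mul_assoc Xᴴ, hXAU]; simp
    have e2 : V * (Uᴴ * (A * (X * C t))) = 0 := by
      rw [← Matrix.mul_assoc A, ← Matrix.mul_assoc Uᴴ, hUAX]; simp
    simp only [Y, ← hXAX, Matrix.add_mul, Matrix.mul_add, Matrix.smul_mul, Matrix.mul_smul,
      Matrix.mul_assoc, e1, e2, smul_zero, add_zero, zero_add, smul_smul, pow_two]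
  have hevsq : ∀ᶠ t in 𝓝 (0 : ℝ), ∀ j, 0 < 1 - t ^ 2 * ω j := by
    refine eventually_all.mpr fun j => continuousAt_const.eventually_lt (by fun_prop) ?_
    simp
  have hloc : ∀ᶠ t in 𝓝 (0 : ℝ), Y t ∈ OBset n p → gmu A μ X ≤ gmu A μ (Y t) := by
    have := hYcont.tendsto 0
    rw [hY0] at this
    exact this.eventually hmin
  have hVV : ((V * Vᴴ) * (V * Vᴴ)).trace = 1 := by
    rw [Matrix.mul_assoc, ← Matrix.mul_assoc Vᴴ, hV, Matrix.one_mul, Matrix.trace_mul_comm, hV]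
    simp
  have hVa : (V * (Uᴴ * A * U) * Vᴴ).trace = (Uᴴ * A * U).trace := by
    rw [Matrix.trace_mul_comm, ← Matrix.mul_assoc, hV, Matrix.one_mul]
  let f : ℝ → ℝ := fun t => (1 / 2) * (-d + (Uᴴ * A * U).trace.re) +
    (μ / 2) * ((C t * G * C t) * (V * Vᴴ)).trace.re +
    (μ / 4) * t ^ 2 * (1 + (W * G * (W * G)).trace.re)
  have hfcont : Continuous f := by
    refine Continuous.add (Continuous.add continuous_const ?_) (by fun_prop)
    refine continuous_const.mul (Complex.continuous_re.comp ?_)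
    exact Continuous.matrix_trace (by fun_prop)
  have hfin : ∀ᶠ t in 𝓝 (0 : ℝ), 0 ≤ t ^ 2 * f t := by
    filter_upwards [hevsq, hloc] with t ht hl
    have hCC : C t * C t = 1 - ((t : ℂ) ^ 2) • W := by
      simp only [C, W, diagonal_mul_diagonal]
      ext i j
      by_cases hij : i = j
      · subst hij
        have h := Real.sq_sqrt (ht i).le
        simp only [diagonal_apply_eq, Matrix.sub_apply, Matrix.one_apply_eq, Matrix.smul_apply,
          smul_eq_mul, c]
        exact_mod_cast (pow_two _).symm.trans h
      · simp [hij]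
    have hCMC : ∀ M : Matrix (Fin p) (Fin p) ℂ,
        (C t * M * C t).trace = M.trace - (t : ℂ) ^ 2 * (W * M).trace := fun M => by
      rw [Matrix.trace_mul_comm, ← Matrix.mul_assoc, hCC, Matrix.sub_mul, Matrix.one_mul,
        Matrix.smul_mul, Matrix.trace_sub, Matrix.trace_smul, smul_eq_mul]
    have hYOB : Y t ∈ OBset n p := fun j => by
      have h1 : (C t * C t) j j = 1 - (t : ℂ) ^ 2 * ω j := by
        rw [hCC]; simp [W]
      have h2 : (V * Vᴴ) j j = ω j := by
        simp [Matrix.mul_apply, ω, Complex.mul_conj]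
      have h3 : (C t * G * C t) j j = (C t * C t) j j * G j j := by
        simp only [C, diagonal_mul, mul_diagonal, diagonal_apply_eq]
        ring
      rw [hYY, Matrix.add_apply, h3, h1, hG, show (Xᴴ * X) j j = 1 from hX j, Matrix.smul_apply, h2,
        smul_eq_mul]
      ring
    have hT1 : ((Y t)ᴴ * A * Y t).trace = d * G.trace - μ * (G * G).trace +
        (t : ℂ) ^ 2 * (-d + μ * (W * (G * G)).trace + (Uᴴ * A * U).trace) := by
      rw [hYAY, Matrix.trace_add, hCMC, Matrix.trace_smul, hVa]
      simp only [Matrix.mul_sub, Matrix.mul_smul, Matrix.trace_sub, Matrix.trace_smul, hWG,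
        smul_eq_mul]
      ring
    have hT0 : (Xᴴ * A * X).trace = d * G.trace - μ * (G * G).trace := by
      rw [Matrix.mul_assoc, hXAX]
      simp only [Matrix.trace_sub, Matrix.trace_smul, smul_eq_mul]
    have hQ : ((C t * G * C t) * (C t * G * C t)).trace = (G * G).trace -
        2 * (t : ℂ) ^ 2 * (W * (G * G)).trace + (t : ℂ) ^ 4 * (W * G * (W * G)).trace := by
      have e : (C t * G * C t) * (C t * G * C t) = C t * (G * (C t * C t) * G) * C t := by
        simp only [Matrix.mul_assoc]
      have e2 : (G * W * G).trace = (W * (G * G)).trace := by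
        rw [Matrix.trace_mul_comm, ← Matrix.mul_assoc, Matrix.trace_mul_comm]
      rw [e, hCMC, hCC]
      simp only [Matrix.mul_sub, Matrix.sub_mul, Matrix.mul_one, Matrix.mul_smul, Matrix.smul_mul,
        Matrix.trace_sub, Matrix.trace_smul, smul_eq_mul, e2]
      simp only [Matrix.mul_assoc]
      ring
    have hT2 : (((Y t)ᴴ * Y t) * ((Y t)ᴴ * Y t)).trace = (G * G).trace -
        2 * (t : ℂ) ^ 2 * (W * (G * G)).trace + (t : ℂ) ^ 4 * (W * G * (W * G)).trace +
        2 * (t : ℂ) ^ 2 * ((C t * G * C t) * (V * Vᴴ)).trace + (t : ℂ) ^ 4 := by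
      rw [hYY, Matrix.add_mul, Matrix.mul_add, Matrix.mul_add, Matrix.trace_add, Matrix.trace_add,
        Matrix.trace_add, hQ, Matrix.smul_mul, Matrix.smul_mul, Matrix.mul_smul, Matrix.mul_smul]
      simp only [Matrix.trace_smul, hVV, smul_eq_mul,
        Matrix.trace_mul_comm (V * Vᴴ) (C t * G * C t)]
      ring
    have h := sub_nonneg.mpr (hl hYOB)
    rw [gmu, gmu, hT1, hT2, hT0] at h
    norm_cast at h
    simp only [Complex.add_re, Complex.sub_re, Complex.re_ofReal_mul, Complex.ofReal_re,
      ← hG] at h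
    refine h.trans_eq ?_
    ring
  have h := nonneg_of_eventually_mul_nonneg hfcont.continuousAt hfin
  simp only [f, hC0, Matrix.one_mul, Matrix.mul_one] at h
  linarith

lemma second_order_of_isLocalMin_mulVec {n p : ℕ} {A : Matrix (Fin n) (Fin n) ℂ}
    (hA : A.IsHermitian) (μ : ℝ) {X : Matrix (Fin n) (Fin p) ℂ} (hX : X ∈ OBset n p)
    (hmin : ∀ᶠ Y in 𝓝 X, Y ∈ OBset n p → gmu A μ X ≤ gmu A μ Y) {d : ℝ}
    (hd : A * X = (d : ℂ) • X - (μ : ℂ) • (X * (Xᴴ * X)))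
    {u : Fin n → ℂ} {v : Fin p → ℂ} (hv : star v ⬝ᵥ v = 1) (hXu : Xᴴ *ᵥ u = 0) :
    (d - μ * (star v ⬝ᵥ (Xᴴ * X) *ᵥ v).re) * (star u ⬝ᵥ u).re ≤ (star u ⬝ᵥ A *ᵥ u).re := by
  rcases (dotProduct_self_nonneg u).eq_or_lt with h0 | hpos
  · have : u = 0 := eq_zero_of_dotProduct_self_re h0.symm
    simp [this]
  set N := (star u ⬝ᵥ u).re with hN
  have hNc : (N : ℂ) = star u ⬝ᵥ u := dotProduct_self_ofReal u
  set s : ℝ := (Real.sqrt N)⁻¹ with hs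
  have hsN : s ^ 2 * N = 1 := by
    rw [hs, inv_pow, Real.sq_sqrt hpos.le, inv_mul_cancel₀ hpos.ne']
  have hquad : ∀ {m : ℕ} (B : Matrix (Fin m) (Fin m) ℂ) (x : Fin m → ℂ),
      ((replicateCol (Fin 1) x)ᴴ * B * replicateCol (Fin 1) x).trace = star x ⬝ᵥ B *ᵥ x := by
    intro m B x
    rw [Matrix.mul_assoc, Matrix.trace_fin_one]
    rfl
  have hone : ∀ {m : ℕ} {x : Fin m → ℂ}, star x ⬝ᵥ x = 1 →
      (replicateCol (Fin 1) x)ᴴ * replicateCol (Fin 1) x = 1 := by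
    intro m x hx
    ext i j
    rw [Subsingleton.elim j i, Matrix.one_apply_eq]
    exact hx
  have hstar : star ((s : ℂ) • u) = (s : ℂ) • star u := by ext; simp
  have hXU : Xᴴ * replicateCol (Fin 1) ((s : ℂ) • u) = 0 := by
    ext i j
    change (Xᴴ *ᵥ ((s : ℂ) • u)) i = 0
    simp [mulVec_smul, hXu]
  have hunit : star ((s : ℂ) • u) ⬝ᵥ ((s : ℂ) • u) = 1 := by
    rw [hstar, smul_dotProduct, dotProduct_smul, ← hNc, smul_eq_mul, smul_eq_mul]
    rw [← mul_assoc, ← pow_two]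
    exact_mod_cast hsN
  have h := second_order_of_isLocalMin hA μ hX hmin hd (hone hunit) (hone hv) hXU
  rw [hquad, ← Matrix.mul_assoc (Xᴴ * X), Matrix.trace_mul_comm (Xᴴ * X * _),
    ← Matrix.mul_assoc _ (Xᴴ * X), hquad] at h
  simp only [hstar, mulVec_smul, smul_dotProduct, dotProduct_smul, smul_eq_mul,
    Complex.re_ofReal_mul] at h
  have h3 := mul_le_mul_of_nonneg_right h hpos.le
  have e : (s * (s * (star u ⬝ᵥ A *ᵥ u).re) + μ * (star v ⬝ᵥ (Xᴴ * X) *ᵥ v).re) * N =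
      (star u ⬝ᵥ A *ᵥ u).re + μ * (star v ⬝ᵥ (Xᴴ * X) *ᵥ v).re * N := by
    linear_combination (star u ⬝ᵥ A *ᵥ u).re * hsN
  rw [e] at h3
  linarith

lemma star_mulVec_dotProduct_mulVec {n q : ℕ} {R : Matrix (Fin n) (Fin q) ℂ} (hR : Rᴴ * R = 1)
    (b c : Fin q → ℂ) : star (R *ᵥ b) ⬝ᵥ R *ᵥ c = star b ⬝ᵥ c := by
  rw [star_mulVec, ← dotProduct_mulVec, mulVec_mulVec, hR, one_mulVec]

lemma dotProduct_diagonal_mulVec {q : ℕ} (β : Fin q → ℝ) (b : Fin q → ℂ) :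
    star b ⬝ᵥ (diagonal fun i => (β i : ℂ)) *ᵥ b =
      ((∑ i, β i * Complex.normSq (b i) : ℝ) : ℂ) := by
  simp only [dotProduct, mulVec_diagonal, Pi.star_apply, RCLike.star_def]
  push_cast
  refine Finset.sum_congr rfl fun i _ => ?_
  rw [Complex.normSq_eq_conj_mul_self]
  ring

lemma dotProduct_mulVec_eigenframe {n q : ℕ} {A : Matrix (Fin n) (Fin n) ℂ}
    {R : Matrix (Fin n) (Fin q) ℂ} {β : Fin q → ℝ} (hR : Rᴴ * R = 1)
    (hAR : A * R = R * diagonal fun i => (β i : ℂ)) (b : Fin q → ℂ) :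
    star (R *ᵥ b) ⬝ᵥ A *ᵥ (R *ᵥ b) = ((∑ i, β i * Complex.normSq (b i) : ℝ) : ℂ) := by
  rw [mulVec_mulVec, hAR, ← mulVec_mulVec, star_mulVec_dotProduct_mulVec hR,
    dotProduct_diagonal_mulVec]

/-- Comparison of eigenvalues: if `R` is an orthonormal frame of eigenvectors with nondecreasing
eigenvalues `β` which are dominated by the quadratic form on the orthogonal complement of `R`, then
`β k` is at most the largest eigenvalue on any invariant `(k+1)`-dimensional subspace. -/
lemma eigenframe_le {n q j : ℕ} {A : Matrix (Fin n) (Fin n) ℂ} (hA : A.IsHermitian)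
    {P : Matrix (Fin n) (Fin (j + 1)) ℂ} {α : Fin (j + 1) → ℝ} (hP : Pᴴ * P = 1)
    (hAP : A * P = P * diagonal fun i => (α i : ℂ))
    {R : Matrix (Fin n) (Fin q) ℂ} {β : Fin q → ℝ} (hR : Rᴴ * R = 1)
    (hAR : A * R = R * diagonal fun i => (β i : ℂ)) (hβ : Monotone β)
    (hperp : ∀ u, Rᴴ *ᵥ u = 0 → ∀ k, β k * (star u ⬝ᵥ u).re ≤ (star u ⬝ᵥ A *ᵥ u).re)
    (k : Fin q) (hk : (k : ℕ) = j) {a : ℝ} (ha : ∀ i, α i ≤ a) : β k ≤ a := by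
  have hjq : j ≤ q := hk ▸ k.2.le
  obtain ⟨x, hxker, hx0⟩ := (Submodule.ne_bot_iff _).mp
    (LinearMap.ker_ne_bot_of_finrank_lt
      (f := ((Rᴴ * P).submatrix (Fin.castLE hjq) id).mulVecLin) (by simp))
  set z := P *ᵥ x with hz
  set b := Rᴴ *ᵥ z with hb
  have hb0 : ∀ i : Fin q, i < k → b i = 0 := by
    intro i hi
    have h := congrFun (LinearMap.mem_ker.mp hxker) ⟨i, by omega⟩
    rw [hb, hz, mulVec_mulVec]
    exact h
  set u := z - R *ᵥ b with hu
  have hRu : Rᴴ *ᵥ u = 0 := by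
    rw [hu, mulVec_sub, mulVec_mulVec b, hR, one_mulVec, hb, sub_self]
  have hzd : z = R *ᵥ b + u := by rw [hu]; abel
  have huR : ∀ c : Fin q → ℂ, star u ⬝ᵥ R *ᵥ c = 0 := by
    intro c
    have : star u ᵥ* R = star (Rᴴ *ᵥ u) := by rw [star_mulVec, conjTranspose_conjTranspose]
    rw [dotProduct_mulVec, this, hRu, star_zero, zero_dotProduct]
  have hRu' : ∀ c : Fin q → ℂ, star (R *ᵥ c) ⬝ᵥ u = 0 := by
    intro c
    rw [star_dotProduct, huR, star_zero]
  have huA : star u ⬝ᵥ A *ᵥ (R *ᵥ b) = 0 := by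
    rw [mulVec_mulVec, hAR, ← mulVec_mulVec, huR]
  have hAu : star (R *ᵥ b) ⬝ᵥ A *ᵥ u = 0 := by
    rw [← hA.star_dotProduct_mulVec_comm, huA, star_zero]
  have hzz : (star z ⬝ᵥ z).re = (∑ i, Complex.normSq (b i)) + (star u ⬝ᵥ u).re := by
    rw [hzd, star_add, add_dotProduct, dotProduct_add, dotProduct_add, huR, hRu',
      star_mulVec_dotProduct_mulVec hR, star_dotProduct_self]
    simp
  have hzAz : (star z ⬝ᵥ A *ᵥ z).re =
      (∑ i, β i * Complex.normSq (b i)) + (star u ⬝ᵥ A *ᵥ u).re := by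
    rw [hzd, mulVec_add, star_add, add_dotProduct, dotProduct_add, dotProduct_add, huA, hAu,
      dotProduct_mulVec_eigenframe hR hAR]
    simp [-Complex.ofReal_sum]
  have hxx : (star z ⬝ᵥ z).re = ∑ i, Complex.normSq (x i) := by
    rw [hz, star_mulVec_dotProduct_mulVec hP, star_dotProduct_self, Complex.ofReal_re]
  have hxAx : (star z ⬝ᵥ A *ᵥ z).re = ∑ i, α i * Complex.normSq (x i) := by
    rw [hz, dotProduct_mulVec_eigenframe hP hAP, Complex.ofReal_re]
  have hpos : 0 < (star z ⬝ᵥ z).re := by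
    refine (dotProduct_self_nonneg z).lt_of_ne' fun h => hx0 ?_
    rw [hz, star_mulVec_dotProduct_mulVec hP] at h
    exact eq_zero_of_dotProduct_self_re h
  have hup : (star z ⬝ᵥ A *ᵥ z).re ≤ a * (star z ⬝ᵥ z).re := by
    rw [hxAx, hxx, Finset.mul_sum]
    exact Finset.sum_le_sum fun i _ => mul_le_mul_of_nonneg_right (ha i) (Complex.normSq_nonneg _)
  have hlow : β k * (star z ⬝ᵥ z).re ≤ (star z ⬝ᵥ A *ᵥ z).re := by
    rw [hzz, hzAz, mul_add, Finset.mul_sum]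
    refine add_le_add (Finset.sum_le_sum fun i _ => ?_) (hperp u hRu k)
    rcases lt_or_ge i k with hi | hi
    · simp [hb0 i hi]
    · exact mul_le_mul_of_nonneg_right (hβ hi) (Complex.normSq_nonneg _)
  exact le_of_mul_le_mul_right (hlow.trans hup) hpos

lemma eigenframe_submatrix {n q r : ℕ} {A : Matrix (Fin n) (Fin n) ℂ}
    {R : Matrix (Fin n) (Fin q) ℂ} {β : Fin q → ℝ} (hR : Rᴴ * R = 1)
    (hAR : A * R = R * diagonal fun i => (β i : ℂ)) {e : Fin r → Fin q}
    (he : Function.Injective e) :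
    (R.submatrix id e)ᴴ * R.submatrix id e = 1 ∧
      A * R.submatrix id e = R.submatrix id e * diagonal fun i => (β (e i) : ℂ) := by
  constructor
  · ext i k
    have h : ((R.submatrix id e)ᴴ * R.submatrix id e) i k =
        (1 : Matrix (Fin q) (Fin q) ℂ) (e i) (e k) :=
      congrFun (congrFun hR (e i)) (e k)
    simp only [h, Matrix.one_apply, he.eq_iff]
  · ext i k
    have := congrFun (congrFun hAR i) (e k)
    rw [mul_diagonal] at this ⊢
    exact this

lemma exists_eigenframe {n : ℕ} {A : Matrix (Fin n) (Fin n) ℂ} (hA : A.IsHermitian)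
    (τ : Equiv.Perm (Fin n)) :
    ∃ E : Matrix (Fin n) (Fin n) ℂ, Eᴴ * E = 1 ∧
      A * E = E * diagonal fun i => (hA.eigenvalues (τ i) : ℂ) := by
  have h1 : (hA.eigenvectorUnitary : Matrix (Fin n) (Fin n) ℂ)ᴴ * hA.eigenvectorUnitary = 1 :=
    Unitary.coe_star_mul_self hA.eigenvectorUnitary
  have h2 : A * (hA.eigenvectorUnitary : Matrix (Fin n) (Fin n) ℂ) =
      hA.eigenvectorUnitary * diagonal fun i => (hA.eigenvalues i : ℂ) := by
    ext i k
    rw [mul_diagonal]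
    have := congrFun (hA.mulVec_eigenvectorBasis k) i
    simpa [mul_comm, Matrix.mul_apply, mulVec, dotProduct] using this
  exact ⟨_, eigenframe_submatrix h1 h2 τ.injective⟩

/-- An orthonormal frame of eigenvectors with nondecreasing eigenvalues which are dominated by the
quadratic form on the orthogonal complement realizes the smallest eigenvalues. -/
lemma sortedEig_eq_of_eigenframe {n p : ℕ} (hpn : p ≤ n) {A : Matrix (Fin n) (Fin n) ℂ}
    (hA : A.IsHermitian) {R : Matrix (Fin n) (Fin p) ℂ} {β : Fin p → ℝ} (hR : Rᴴ * R = 1)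
    (hAR : A * R = R * diagonal fun i => (β i : ℂ)) (hβ : Monotone β)
    (hperp : ∀ u, Rᴴ *ᵥ u = 0 → ∀ k, β k * (star u ⬝ᵥ u).re ≤ (star u ⬝ᵥ A *ᵥ u).re)
    (k : Fin p) : sortedEig hA (Fin.castLE hpn k) = β k := by
  obtain ⟨E, hE, hAE⟩ := exists_eigenframe hA (Tuple.sort hA.eigenvalues)
  have hmono : Monotone (sortedEig hA) := Tuple.monotone_sort hA.eigenvalues
  refine le_antisymm ?_ ?_
  · obtain ⟨h1, h2⟩ := eigenframe_submatrix (e := Fin.castLE (Nat.succ_le_of_lt k.2)) hR hAR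
      (Fin.castLE_injective _)
    refine eigenframe_le hA h1 h2 hE (β := sortedEig hA) hAE hmono (fun u hu l => ?_) _ rfl
      fun i => hβ (Fin.le_def.mpr (Nat.le_of_lt_succ i.2))
    have : u = 0 := by
      rw [← one_mulVec u, ← mul_eq_one_comm.mp hE, ← mulVec_mulVec, hu, mulVec_zero]
    simp [this]
  · obtain ⟨h1, h2⟩ := eigenframe_submatrix (β := sortedEig hA)
      (e := Fin.castLE (Nat.succ_le_of_lt (k.2.trans_le hpn))) hE hAE (Fin.castLE_injective _)
    exact eigenframe_le hA h1 h2 hR hAR hβ hperp k rfl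
      fun i => hmono (Fin.le_def.mpr (Nat.le_of_lt_succ i.2))

lemma le_dotProduct_mulVec_of_le_eigenvalues {n : ℕ} {A : Matrix (Fin n) (Fin n) ℂ}
    (hA : A.IsHermitian) {m : ℝ} (hm : ∀ i, m ≤ hA.eigenvalues i) (z : Fin n → ℂ) :
    m * (star z ⬝ᵥ z).re ≤ (star z ⬝ᵥ A *ᵥ z).re := by
  obtain ⟨E, hE, hAE⟩ := exists_eigenframe hA (Equiv.refl _)
  have hz : z = E *ᵥ (Eᴴ *ᵥ z) := by
    rw [mulVec_mulVec, mul_eq_one_comm.mp hE, one_mulVec]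
  rw [hz, star_mulVec_dotProduct_mulVec hE, star_dotProduct_self,
    dotProduct_mulVec_eigenframe hE hAE, Complex.ofReal_re, Complex.ofReal_re, Finset.mul_sum]
  exact Finset.sum_le_sum fun i _ => mul_le_mul_of_nonneg_right (hm _) (Complex.normSq_nonneg _)

lemma exists_conjTranspose_mulVec_eq_zero {n p : ℕ} (hpn : p ≤ n) {X : Matrix (Fin n) (Fin p) ℂ}
    {v : Fin p → ℂ} (hv : v ≠ 0) (hXv : X *ᵥ v = 0) : ∃ u ≠ 0, Xᴴ *ᵥ u = 0 := by
  by_contra! h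
  have hinj : Function.Injective Xᴴ.mulVecLin :=
    (injective_iff_map_eq_zero _).mpr fun u hu => by_contra fun h0 => h u h0 hu
  have h1 : X.rank = n := by
    open scoped ComplexOrder in
    rw [← rank_conjTranspose, rank, LinearMap.finrank_range_of_inj hinj, Module.finrank_fin_fun]
  have h2 := X.mulVecLin.finrank_range_add_finrank_ker
  have h3 : 0 < Module.finrank ℂ (LinearMap.ker X.mulVecLin) :=
    Module.finrank_pos_iff.mpr ⟨⟨⟨v, hXv⟩, 0, fun h0 => hv (congrArg Subtype.val h0)⟩⟩
  rw [show Module.finrank ℂ (LinearMap.range X.mulVecLin) = n from h1,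
    Module.finrank_fin_fun] at h2
  omega

/-- The common multiplier of the columns of a stationary point is positive. -/
lemma multiplier_pos {n p : ℕ} (hp : 0 < p) {A : Matrix (Fin n) (Fin n) ℂ}
    (hA : A.IsHermitian) {μ : ℝ} (hμ0 : 0 < μ) {m : ℝ} (hmμ : -μ < m)
    (hm : ∀ i, m ≤ hA.eigenvalues i)
    {X : Matrix (Fin n) (Fin p) ℂ} (hX : X ∈ OBset n p) {d : ℝ}
    (hd : A * X = (d : ℂ) • X - (μ : ℂ) • (X * (Xᴴ * X))) : 0 < d := by
  have hp' : (0 : ℝ) < p := by exact_mod_cast hp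
  have htrG : (Xᴴ * X).trace = p := by
    simp only [Matrix.trace, Matrix.diag_apply, show ∀ j, (Xᴴ * X) j j = 1 from hX]
    simp
  have h1 : (Xᴴ * (A * X)).trace.re = d * p - μ * ((Xᴴ * X) * (Xᴴ * X)).trace.re := by
    rw [hd, Matrix.mul_sub, Matrix.mul_smul, Matrix.mul_smul, ← Matrix.mul_assoc,
      Matrix.trace_sub, Matrix.trace_smul, Matrix.trace_smul, htrG]
    simp
  have h2 : m * p ≤ (Xᴴ * (A * X)).trace.re := by
    have e : (Xᴴ * (A * X)).trace = ∑ j, star (X.col j) ⬝ᵥ A *ᵥ X.col j := rfl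
    rw [e, Complex.re_sum]
    calc m * p = ∑ _j : Fin p, m := by simp [mul_comm]
      _ ≤ _ := Finset.sum_le_sum fun j _ => by
        have := le_dotProduct_mulVec_of_le_eigenvalues hA hm (X.col j)
        rwa [mem_OBset_iff.mp hX j, Complex.one_re, mul_one] at this
  have h3 : (p : ℝ) ≤ ((Xᴴ * X) * (Xᴴ * X)).trace.re := by
    have hG : (Xᴴ * X)ᴴ = Xᴴ * X := by simp [conjTranspose_mul]
    have e : ((Xᴴ * X) * (Xᴴ * X)).trace =
        ((∑ i, ∑ j, Complex.normSq ((Xᴴ * X) j i) : ℝ) : ℂ) := by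
      nth_rewrite 1 [← hG]
      simp only [Matrix.trace, Matrix.diag_apply, Matrix.mul_apply (M := (Xᴴ * X)ᴴ),
        conjTranspose_apply]
      push_cast
      simp only [Complex.normSq_eq_conj_mul_self]
      rfl
    rw [e, Complex.ofReal_re]
    calc (p : ℝ) = ∑ i : Fin p, Complex.normSq ((Xᴴ * X) i i) := by
          simp [show ∀ j, (Xᴴ * X) j j = 1 from hX]
      _ ≤ _ := Finset.sum_le_sum fun i _ =>
          Finset.single_le_sum (f := fun j => Complex.normSq ((Xᴴ * X) j i))
            (fun j _ => Complex.normSq_nonneg _) (Finset.mem_univ i)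
  nlinarith [mul_le_mul_of_nonneg_left h3 hμ0.le, mul_lt_mul_of_pos_right hmμ hp']

/-- local minimizers of qTPM over the oblique manifold take the form
`Q_p (I − (Λ_p − Λ̄_p)/μ)^{1/2} V^*`. -/
theorem qTPM_local_minimizers {n p : ℕ} (hn : 0 < n) (hp : 0 < p) (hpn : p ≤ n)
    (A : Matrix (Fin n) (Fin n) ℂ) (hA : A.IsHermitian)
    (hneg : ∀ z : Fin n → ℂ, z ≠ 0 → (star z ⬝ᵥ A.mulVec z).re < 0)
    (μ : ℝ) (hμ : |⨅ i, hA.eigenvalues i| < μ)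
    (X : Matrix (Fin n) (Fin p) ℂ) (hX : X ∈ OBset n p)
    (hmin : ∃ δ > (0 : ℝ), ∀ Y ∈ OBset n p, frobNorm (Y - X) < δ → gmu A μ X ≤ gmu A μ Y) :
    ∃ (Q : Matrix (Fin n) (Fin p) ℂ) (V : Matrix (Fin p) (Fin p) ℂ),
      Qᴴ * Q = 1 ∧
      A * Q = Q * Matrix.diagonal (fun j : Fin p => (sortedEig hA (Fin.castLE hpn j) : ℂ)) ∧
      Vᴴ * V = 1 ∧ V * Vᴴ = 1 ∧
      X = Q * Matrix.diagonal (fun j : Fin p =>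
        (Real.sqrt (1 - (sortedEig hA (Fin.castLE hpn j)
          - (∑ l : Fin p, sortedEig hA (Fin.castLE hpn l)) / p) / μ) : ℂ)) * Vᴴ := by
  have hmin' := isLocalMinOn_of_frobNorm hmin
  have hμ0 : 0 < μ := (abs_nonneg _).trans_lt hμ
  obtain ⟨d, hd⟩ := stationary_of_isLocalMin hp hA μ hX hmin'
  have hd0 : 0 < d := multiplier_pos hp hA hμ0 (neg_lt_of_abs_lt hμ)
    (fun i => ciInf_le (Set.finite_range _).bddBelow i) hX hd
  have hso := fun u v => second_order_of_isLocalMin_mulVec hA μ hX hmin' hd (u := u) (v := v)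
  have hG : (Xᴴ * X).IsHermitian := isHermitian_conjTranspose_mul_self X
  set τ := Tuple.sort fun i => d - μ * hG.eigenvalues i with hτ
  obtain ⟨E, hE, hGE⟩ := exists_eigenframe hG τ
  set σ : Fin p → ℝ := fun i => hG.eigenvalues (τ i) with hσ
  have hβ : Monotone fun i => d - μ * σ i :=
    Tuple.monotone_sort fun i => d - μ * hG.eigenvalues i
  have hE' : E * Eᴴ = 1 := mul_eq_one_comm.mp hE
  have hcol : ∀ k, star (E.col k) ⬝ᵥ E.col k = 1 := fun k => by
    have := congrFun (congrFun hE k) k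
    rwa [Matrix.one_apply_eq] at this
  have hGcol : ∀ k, (Xᴴ * X) *ᵥ E.col k = (σ k : ℂ) • E.col k := fun k => by
    ext i
    have := congrFun (congrFun hGE i) k
    rw [mul_diagonal, mul_comm] at this
    exact this
  have hsσ : ∀ k, star (E.col k) ⬝ᵥ (Xᴴ * X) *ᵥ E.col k = σ k := fun k => by
    rw [hGcol, dotProduct_smul, hcol, smul_eq_mul, mul_one]
  have hcompl : ∀ u, Xᴴ *ᵥ u = 0 → ∀ k,
      (d - μ * σ k) * (star u ⬝ᵥ u).re ≤ (star u ⬝ᵥ A *ᵥ u).re := fun u hu k => by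
    have := hso u (E.col k) (hcol k) hu
    rwa [hsσ, Complex.ofReal_re] at this
  have hXE : ∀ k, (star (X *ᵥ E.col k) ⬝ᵥ X *ᵥ E.col k).re = σ k := fun k => by
    rw [star_mulVec, ← dotProduct_mulVec, mulVec_mulVec, hsσ, Complex.ofReal_re]
  have hσpos : ∀ k, 0 < σ k := fun k => by
    refine (hXE k ▸ dotProduct_self_nonneg (X *ᵥ E.col k)).lt_of_ne' fun h0 => ?_
    have hEk : E.col k ≠ 0 := fun h => by simpa [h] using hcol k
    obtain ⟨u, hu0, hu⟩ := exists_conjTranspose_mulVec_eq_zero hpn hEk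
      (eq_zero_of_dotProduct_self_re ((hXE k).trans h0))
    have h1 := hcompl u hu k
    rw [h0, mul_zero, sub_zero] at h1
    exact absurd (hneg u hu0) (not_lt.mpr ((mul_nonneg hd0.le (dotProduct_self_nonneg u)).trans h1))
  have hsq : ∀ k, (Real.sqrt (σ k) : ℂ) * Real.sqrt (σ k) = σ k := fun k => by
    exact_mod_cast Real.mul_self_sqrt (hσpos k).le
  have hsq0 : ∀ k, (Real.sqrt (σ k) : ℂ) ≠ 0 := fun k => by
    exact_mod_cast (Real.sqrt_pos.mpr (hσpos k)).ne'
  set S : Matrix (Fin p) (Fin p) ℂ := diagonal fun k => (Real.sqrt (σ k) : ℂ) with hS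
  set D : Matrix (Fin p) (Fin p) ℂ := diagonal fun k => (Real.sqrt (σ k) : ℂ)⁻¹ with hD
  have hDS : D * S = 1 := by
    rw [hD, hS, diagonal_mul_diagonal, ← diagonal_one]
    exact congrArg diagonal (funext fun k => inv_mul_cancel₀ (hsq0 k))
  have hDH : Dᴴ = D := by
    simp [hD, diagonal_conjTranspose, Pi.star_def]
  set Q : Matrix (Fin n) (Fin p) ℂ := X * E * D with hQ
  have hXQ : X = Q * S * Eᴴ := by
    rw [hQ, Matrix.mul_assoc (X * E), hDS, Matrix.mul_one, Matrix.mul_assoc, hE', Matrix.mul_one]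
  have hQQ : Qᴴ * Q = 1 := by
    have e : Qᴴ * Q = D * (Eᴴ * ((Xᴴ * X) * E)) * D := by
      rw [hQ, conjTranspose_mul, conjTranspose_mul, hDH]
      simp only [Matrix.mul_assoc]
    rw [e, hGE, ← Matrix.mul_assoc Eᴴ, hE, Matrix.one_mul, hD, diagonal_mul_diagonal,
      diagonal_mul_diagonal, ← diagonal_one]
    refine congrArg diagonal (funext fun k => ?_)
    change (Real.sqrt (σ k) : ℂ)⁻¹ * (σ k : ℂ) * (Real.sqrt (σ k) : ℂ)⁻¹ = 1
    rw [← hsq k]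
    field_simp [hsq0 k]
  have hAQ : A * Q = Q * diagonal fun k => ((d - μ * σ k : ℝ) : ℂ) := by
    have e : A * Q = (d : ℂ) • (X * E * D) - (μ : ℂ) • (X * ((Xᴴ * X) * E) * D) := by
      rw [hQ, ← Matrix.mul_assoc, ← Matrix.mul_assoc, hd]
      simp only [Matrix.sub_mul, Matrix.smul_mul, Matrix.mul_assoc]
    rw [e, hGE, hQ, ← Matrix.mul_assoc X]
    ext i k
    simp only [hD, Matrix.sub_apply, Matrix.smul_apply, mul_diagonal, smul_eq_mul]
    push_cast
    ring
  have heig : ∀ k, sortedEig hA (Fin.castLE hpn k) = d - μ * σ k := by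
    refine sortedEig_eq_of_eigenframe hpn hA hQQ hAQ hβ fun u hu => hcompl u ?_
    have hSH : (Q * S * Eᴴ)ᴴ = E * Sᴴ * Qᴴ := by
      simp [conjTranspose_mul, Matrix.mul_assoc]
    rw [hXQ, hSH, ← mulVec_mulVec, hu, mulVec_zero]
  have hsum : ∑ k, σ k = p := by
    have h1 : (Xᴴ * X).trace = p := by
      simp only [Matrix.trace, Matrix.diag_apply, show ∀ j, (Xᴴ * X) j j = 1 from hX]
      simp
    have h2 : (Xᴴ * X).trace = ∑ k, (σ k : ℂ) := by
      rw [← Matrix.mul_one (Xᴴ * X), ← hE', ← Matrix.mul_assoc, hGE, Matrix.trace_mul_comm,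
        ← Matrix.mul_assoc, hE, Matrix.one_mul, Matrix.trace_diagonal]
    exact_mod_cast h2.symm.trans h1
  have hp' : (p : ℝ) ≠ 0 := by exact_mod_cast hp.ne'
  have hσeq : ∀ k, 1 - (sortedEig hA (Fin.castLE hpn k)
      - (∑ l : Fin p, sortedEig hA (Fin.castLE hpn l)) / p) / μ = σ k := fun k => by
    simp only [heig, Finset.sum_sub_distrib, ← Finset.mul_sum, hsum, Finset.sum_const,
      Finset.card_univ, Fintype.card_fin, nsmul_eq_mul]
    field_simp
    ring
  refine ⟨Q, E, hQQ, ?_, hE, hE', ?_⟩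
  · simp only [heig]
    exact hAQ
  · simp only [hσeq]
    exact hXQ
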